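/- In the algebra D~, for all n ∈ ℕ with n ≥ 2 one has u1 * x2^{2n} = x2^{2n} * u1 + n * x2^{2(n-1)} * x1 * g - n(n-1) * x21 * x2^{2(n-2)} * x1 * g, where the integer coefficients are taken in k. -/

import Mathlib

/-!
The Hopf algebra `D~` (double of the super Jordan plane, bosonization stripped),
presented by generators x1, x2, u1, u2, g, g' (= g⁻¹), ζ and the relations
listed in the paper.  We realize it as `RingQuot` of the relation `Rel` on the
free algebra on 7 generators.
-/

namespace SuperJordanDouble

variable (k : Type) [Field k]

noncomputable def fx1 : FreeAlgebra k (Fin 7) := FreeAlgebra.ι k 0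
noncomputable def fx2 : FreeAlgebra k (Fin 7) := FreeAlgebra.ι k 1
noncomputable def fu1 : FreeAlgebra k (Fin 7) := FreeAlgebra.ι k 2
noncomputable def fu2 : FreeAlgebra k (Fin 7) := FreeAlgebra.ι k 3
noncomputable def fg  : FreeAlgebra k (Fin 7) := FreeAlgebra.ι k 4
noncomputable def fgi : FreeAlgebra k (Fin 7) := FreeAlgebra.ι k 5
noncomputable def fz  : FreeAlgebra k (Fin 7) := FreeAlgebra.ι k 6
noncomputable def fx21 : FreeAlgebra k (Fin 7) := fx1 k * fx2 k + fx2 k * fx1 k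
noncomputable def fu21 : FreeAlgebra k (Fin 7) := fu1 k * fu2 k + fu2 k * fu1 k

/-- The defining relations of `D~`. -/
inductive Rel : FreeAlgebra k (Fin 7) → FreeAlgebra k (Fin 7) → Prop
  | x1sq  : Rel (fx1 k * fx1 k) 0
  | x2x21 : Rel (fx2 k * fx21 k) (fx21 k * fx2 k + fx1 k * fx21 k)
  | u1sq  : Rel (fu1 k * fu1 k) 0
  | u2u21 : Rel (fu2 k * fu21 k) (fu21 k * fu2 k + fu1 k * fu21 k)
  | ggi   : Rel (fg k * fgi k) 1
  | gig   : Rel (fgi k * fg k) 1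
  | zg    : Rel (fz k * fg k) (fg k * fz k)
  | gx1   : Rel (fg k * fx1 k) (fx1 k * fg k)
  | gx2   : Rel (fg k * fx2 k) (fx2 k * fg k - fx1 k * fg k)
  | u1g   : Rel (fu1 k * fg k) (fg k * fu1 k)
  | u2g   : Rel (fu2 k * fg k) (fg k * fu2 k - fg k * fu1 k)
  | zx1   : Rel (fz k * fx1 k) (fx1 k * fz k + fx1 k)
  | zx2   : Rel (fz k * fx2 k) (fx2 k * fz k + fx2 k)
  | u1z   : Rel (fu1 k * fz k) (fz k * fu1 k + fu1 k)
  | u2z   : Rel (fu2 k * fz k) (fz k * fu2 k + fu2 k)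
  | u1x1  : Rel (fu1 k * fx1 k) (-(fx1 k * fu1 k))
  | u1x2  : Rel (fu1 k * fx2 k) (-(fx2 k * fu1 k) + 1 - fg k)
  | u2x1  : Rel (fu2 k * fx1 k) (-(fx1 k * fu2 k) + 1 - fg k + fx1 k * fu1 k)
  | u2x2  : Rel (fu2 k * fx2 k) (-(fx2 k * fu2 k) + fg k * fz k + fx2 k * fu1 k)

/-- The algebra `D~`. -/
abbrev tD := RingQuot (Rel k)

noncomputable def x1 : tD k := RingQuot.mkAlgHom k (Rel k) (fx1 k)
noncomputable def x2 : tD k := RingQuot.mkAlgHom k (Rel k) (fx2 k)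
noncomputable def u1 : tD k := RingQuot.mkAlgHom k (Rel k) (fu1 k)
noncomputable def u2 : tD k := RingQuot.mkAlgHom k (Rel k) (fu2 k)
noncomputable def g  : tD k := RingQuot.mkAlgHom k (Rel k) (fg k)
noncomputable def gi : tD k := RingQuot.mkAlgHom k (Rel k) (fgi k)
noncomputable def z  : tD k := RingQuot.mkAlgHom k (Rel k) (fz k)
noncomputable def x21 : tD k := x1 k * x2 k + x2 k * x1 k
noncomputable def u21 : tD k := u1 k * u2 k + u2 k * u1 k

/-- `g^n` for `n : ℤ`, where negative powers are interpreted using `g' = g⁻¹`. -/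
noncomputable def gpow (n : ℤ) : tD k :=
  if 0 ≤ n then g k ^ n.toNat else gi k ^ (-n).toNat

end SuperJordanDouble

open SuperJordanDouble

namespace SuperJordanDouble

section JordanPlane

variable {k A : Type*} [CommRing k] [Ring A] [Algebra k A]

/-- In the Jordan plane `X Y = Y X + Y²`, the powers of `X - 2 Y` in normal form. -/
theorem sub_two_smul_pow {X Y : A} (h : X * Y = Y * X + Y * Y) (m : ℕ) :
    (X - (2 : k) • Y) ^ (m + 2) =
      X ^ (m + 2) - (2 * (m + 2) : k) • (Y * X ^ (m + 1)) +
        ((m + 2) * (m + 1) : k) • (Y * (Y * X ^ m)) := by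
  have hXY (z : A) : X * (Y * z) = Y * (X * z) + Y * (Y * z) := by
    rw [← mul_assoc, h, add_mul, mul_assoc, mul_assoc]
  induction m with
  | zero =>
    simp only [pow_succ', pow_zero, mul_one, mul_sub, sub_mul, smul_mul_assoc, mul_smul_comm,
      zero_add, Nat.cast_zero, h]
    module
  | succ m ih =>
    rw [pow_succ', ih]
    simp only [pow_succ' X, mul_sub, sub_mul, mul_add, smul_mul_assoc, mul_smul_comm, hXY,
      Nat.cast_add, Nat.cast_one]
    module

/-- If `u X = X u + w` and `w X = (X - 2 Y) w`, where `X Y = Y X + Y²`, then moving `u` past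
a power of `X` produces only terms of degree at most one in `Y`. -/
theorem mul_pow_eq_of_skew_comm {X Y u w : A} (h : X * Y = Y * X + Y * Y)
    (hu : u * X = X * u + w) (hw : w * X = (X - (2 : k) • Y) * w) (m : ℕ) :
    u * X ^ (m + 2) =
      X ^ (m + 2) * u + (m + 2 : k) • (X ^ (m + 1) * w) -
        ((m + 2) * (m + 1) : k) • (Y * (X ^ m * w)) := by
  have hXY (z : A) : X * (Y * z) = Y * (X * z) + Y * (Y * z) := by
    rw [← mul_assoc, h, add_mul, mul_assoc, mul_assoc]
  induction m with
  | zero =>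
    rw [zero_add, pow_two, ← mul_assoc, hu, add_mul, hw, mul_assoc, hu]
    simp only [zero_add, pow_one, pow_zero, one_mul, Nat.cast_zero, mul_add, sub_mul,
      smul_mul_assoc, mul_assoc]
    module
  | succ m ih =>
    have hwX : w * X ^ (m + 2) = (X - (2 : k) • Y) ^ (m + 2) * w :=
      (show SemiconjBy w X (X - (2 : k) • Y) from hw).pow_right (m + 2)
    rw [pow_succ' X (m + 2), ← mul_assoc, hu, add_mul, hwX, mul_assoc, ih, sub_two_smul_pow h]
    simp only [pow_succ' X, mul_sub, sub_mul, mul_add, add_mul, smul_mul_assoc, mul_smul_comm,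
      mul_assoc, hXY, Nat.cast_add, Nat.cast_one]
    module

end JordanPlane

section Relations

variable (k : Type) [Field k]

theorem x1_mul_x1 : x1 k * x1 k = 0 := by
  simpa [x1] using RingQuot.mkAlgHom_rel k (Rel.x1sq (k := k))

theorem x2_mul_x21 : x2 k * x21 k = x21 k * x2 k + x1 k * x21 k := by
  simpa [x1, x2, x21, fx21] using RingQuot.mkAlgHom_rel k (Rel.x2x21 (k := k))

theorem g_mul_x2 : g k * x2 k = (x2 k - x1 k) * g k := by
  simpa [g, x1, x2, sub_mul] using RingQuot.mkAlgHom_rel k (Rel.gx2 (k := k))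

theorem u1_mul_x2 : u1 k * x2 k = 1 - g k - x2 k * u1 k := by
  have h : u1 k * x2 k = -(x2 k * u1 k) + 1 - g k := by
    simpa [g, u1, x2] using RingQuot.mkAlgHom_rel k (Rel.u1x2 (k := k))
  rw [h]
  abel

theorem x2_sq_mul_x21 :
    x2 k ^ 2 * x21 k = x21 k * x2 k ^ 2 + x21 k * x21 k := by
  have h := x2_mul_x21 k
  calc x2 k ^ 2 * x21 k = x2 k * x21 k * x2 k + x2 k * x1 k * x21 k := by
        rw [pow_two, mul_assoc, h, mul_add, ← mul_assoc, ← mul_assoc, h]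
    _ = x21 k * x2 k ^ 2 + x1 k * (x21 k * x2 k) + x2 k * x1 k * x21 k := by
        rw [h, add_mul, mul_assoc, mul_assoc, pow_two]
    _ = x21 k * x2 k ^ 2 + (x1 k * x2 k + x2 k * x1 k) * x21 k - x1 k * x1 k * x21 k := by
        rw [eq_sub_of_add_eq h.symm, mul_sub, add_mul, mul_assoc (x1 k), mul_assoc (x1 k)]
        abel
    _ = x21 k * x2 k ^ 2 + x21 k * x21 k := by rw [x1_mul_x1, zero_mul, sub_zero]; rfl

theorem x1_mul_x21 : x1 k * x21 k = x21 k * x1 k := by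
  simp only [x21, mul_add, add_mul, ← mul_assoc, x1_mul_x1, zero_mul]
  simp only [mul_assoc, x1_mul_x1, mul_zero, zero_add, add_zero]

theorem x1_mul_x2_sq : x1 k * x2 k ^ 2 = (x2 k ^ 2 - x21 k) * x1 k := by
  have h : x1 k * x2 k ^ 2 = x21 k * x2 k - x2 k * x21 k + x2 k ^ 2 * x1 k := by
    simp only [x21]; noncomm_ring
  rw [h, x2_mul_x21, x1_mul_x21, sub_mul]
  abel

theorem g_mul_x2_sq : g k * x2 k ^ 2 = (x2 k ^ 2 - x21 k) * g k := by
  have h : (x2 k - x1 k) * (x2 k - x1 k) = x2 k ^ 2 - x21 k := by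
    rw [sub_mul, mul_sub, mul_sub, x1_mul_x1, x21, pow_two]
    abel
  rw [← h, pow_two, ← mul_assoc, g_mul_x2, mul_assoc, g_mul_x2, mul_assoc]

theorem x1_mul_g_mul_x2_sq :
    x1 k * g k * x2 k ^ 2 = (x2 k ^ 2 - (2 : k) • x21 k) * (x1 k * g k) := by
  rw [mul_assoc, g_mul_x2_sq, ← mul_assoc, mul_sub, x1_mul_x2_sq, x1_mul_x21, ← sub_mul,
    mul_assoc, two_smul, sub_sub]

theorem u1_mul_x2_sq : u1 k * x2 k ^ 2 = x2 k ^ 2 * u1 k + x1 k * g k := by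
  rw [pow_two, ← mul_assoc, u1_mul_x2, sub_mul, sub_mul, one_mul, mul_assoc, u1_mul_x2,
    g_mul_x2, mul_sub, mul_sub, mul_one, sub_mul, mul_assoc]
  abel

end Relations

end SuperJordanDouble

/-- In `D~`, for `n ≥ 2`,
`u1 x2^{2n} = x2^{2n} u1 + n x2^{2(n-1)} x1 g - n(n-1) x21 x2^{2(n-2)} x1 g`. -/
theorem superJordanDouble_u1_x2_pow_comm (k : Type) [Field k]
    (hchar : (2 : k) ≠ 0) (n : ℕ) (hn : 2 ≤ n) :
    u1 k * x2 k ^ (2 * n) =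
      x2 k ^ (2 * n) * u1 k + (n : k) • (x2 k ^ (2 * (n - 1)) * x1 k * g k) -
        ((n * (n - 1) : ℕ) : k) • (x21 k * x2 k ^ (2 * (n - 2)) * x1 k * g k) := by
  obtain ⟨m, rfl⟩ := Nat.exists_eq_add_of_le' hn
  have h := mul_pow_eq_of_skew_comm (x2_sq_mul_x21 k) (u1_mul_x2_sq k)
    (x1_mul_g_mul_x2_sq k) m
  simp only [← pow_mul] at h
  simpa [mul_assoc, add_sub_assoc] using h
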